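/- arXiv:2108.01976 — 3 statements merged into one kernel-verified Lean document; each statement's English description precedes it below -/
import Mathlib

section
/- In the system I^ι, for any formulas F and G, any variable x, and any variable y distinct from x and not free in F or in G, the formula ∃x(F ∧ ∀y(F[y/x] → y = x) ∧ G) is derivable from the single assumption ιx[F, G]; moreover there is such a derivation that uses no application of the identity rules =I and =E. -/
/-! ### Syntax: terms and formulas of the language of (free) intuitionist
predicate logic with identity, a primitive existence predicate `exi` (`∃!`),
and the binary definite-description quantifier `iota` (`ιx[F, G]`). -/

/-- First-order terms: variables (numbered) and function symbols applied to
argument tuples. -/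
inductive Tm : Type
  | var : ℕ → Tm
  | func : ℕ → (n : ℕ) → (Fin n → Tm) → Tm

/-- Free variables of a term (all variables occurring in it). -/
def Tm.fv : Tm → Finset ℕ
  | .var x => {x}
  | .func _ _ ts => Finset.univ.biUnion (fun i => (ts i).fv)

/-- Substitution of the term `s` for the variable `v` in a term. -/
def Tm.subst (v : ℕ) (s : Tm) : Tm → Tm
  | .var x => if x = v then s else .var x
  | .func f n ts => .func f n (fun i => Tm.subst v s (ts i))

/-- Formulas: atomic predications, identities `t = u`, existence statements
`∃! t`, `⊥`, `∧`, `∨`, `→`, `∀`, `∃`, and the binary quantifier `ιx[F, G]`. -/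
inductive Fm : Type
  | atom : ℕ → (n : ℕ) → (Fin n → Tm) → Fm
  | eq : Tm → Tm → Fm
  | exi : Tm → Fm
  | bot : Fm
  | and : Fm → Fm → Fm
  | or : Fm → Fm → Fm
  | imp : Fm → Fm → Fm
  | all : ℕ → Fm → Fm
  | ex : ℕ → Fm → Fm
  | iota : ℕ → Fm → Fm → Fm

/-- Free variables of a formula. -/
def Fm.fv : Fm → Finset ℕ
  | .atom _ _ ts => Finset.univ.biUnion (fun i => (ts i).fv)
  | .eq t u => t.fv ∪ u.fv
  | .exi t => t.fv
  | .bot => ∅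
  | .and A B => A.fv ∪ B.fv
  | .or A B => A.fv ∪ B.fv
  | .imp A B => A.fv ∪ B.fv
  | .all x A => A.fv.erase x
  | .ex x A => A.fv.erase x
  | .iota x F G => (F.fv ∪ G.fv).erase x

/-- `A.subst v s` is `A[s/v]`: substitution of the term `s` for all free
occurrences of the variable `v` in `A` (no renaming is performed; rules demand
`s` be free for `v` in `A`, so the substitution is capture-avoiding). -/
def Fm.subst (v : ℕ) (s : Tm) : Fm → Fm
  | .atom P n ts => .atom P n (fun i => Tm.subst v s (ts i))
  | .eq t u => .eq (Tm.subst v s t) (Tm.subst v s u)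
  | .exi t => .exi (Tm.subst v s t)
  | .bot => .bot
  | .and A B => .and (A.subst v s) (B.subst v s)
  | .or A B => .or (A.subst v s) (B.subst v s)
  | .imp A B => .imp (A.subst v s) (B.subst v s)
  | .all x A => if x = v then .all x A else .all x (A.subst v s)
  | .ex x A => if x = v then .ex x A else .ex x (A.subst v s)
  | .iota x F G => if x = v then .iota x F G else .iota x (F.subst v s) (G.subst v s)

/-- `A.freeFor t v`: the term `t` is free for the variable `v` in `A`, i.e. no
free occurrence of a variable of `t` becomes bound after substituting `t` for
the free occurrences of `v` in `A`. -/
def Fm.freeFor (t : Tm) (v : ℕ) : Fm → Prop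
  | .atom _ _ _ => True
  | .eq _ _ => True
  | .exi _ => True
  | .bot => True
  | .and A B => A.freeFor t v ∧ B.freeFor t v
  | .or A B => A.freeFor t v ∧ B.freeFor t v
  | .imp A B => A.freeFor t v ∧ B.freeFor t v
  | .all x A => v = x ∨ v ∉ (Fm.all x A).fv ∨ (x ∉ t.fv ∧ A.freeFor t v)
  | .ex x A => v = x ∨ v ∉ (Fm.ex x A).fv ∨ (x ∉ t.fv ∧ A.freeFor t v)
  | .iota x F G =>
      v = x ∨ v ∉ (Fm.iota x F G).fv ∨ (x ∉ t.fv ∧ F.freeFor t v ∧ G.freeFor t v)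

/-- Atomic formulas: predications, identities and existence statements
(`∃! t` is an atomic formula of degree 0; `⊥` is not atomic). -/
inductive Fm.Atomic : Fm → Prop
  | atom (P n ts) : (Fm.atom P n ts).Atomic
  | eq (t u) : (Fm.eq t u).Atomic
  | exi (t) : (Fm.exi t).Atomic

/-- The variable `y` is not free in any formula of `Γ`. -/
def NotFreeIn (y : ℕ) (Γ : Set Fm) : Prop := ∀ B ∈ Γ, y ∉ B.fv
/-- Derivability in the system `I^ι`: intuitionist predicate logic with
identity and the binary quantifier `ι` governed by the rules `ιI`, `ιE¹`,
`ιE²` of Section 2. The Boolean parameter records whether the identity rules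
`=I` and `=E` may be used: `DervI true Γ A` is derivability in full `I^ι`,
while `DervI false Γ A` is derivability by a deduction containing no
application of `=I` or `=E`. -/
inductive DervI : Bool → Set Fm → Fm → Prop
  | hyp {b : Bool} {Γ : Set Fm} {A : Fm} : A ∈ Γ → DervI b Γ A
  | andI {b : Bool} {Γ : Set Fm} {A B : Fm} : DervI b Γ A → DervI b Γ B → DervI b Γ (.and A B)
  | andE1 {b : Bool} {Γ : Set Fm} {A B : Fm} : DervI b Γ (.and A B) → DervI b Γ A
  | andE2 {b : Bool} {Γ : Set Fm} {A B : Fm} : DervI b Γ (.and A B) → DervI b Γ B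
  | impI {b : Bool} {Γ : Set Fm} {A B : Fm} : DervI b (insert A Γ) B → DervI b Γ (.imp A B)
  | impE {b : Bool} {Γ : Set Fm} {A B : Fm} : DervI b Γ (.imp A B) → DervI b Γ A → DervI b Γ B
  | orI1 {b : Bool} {Γ : Set Fm} {A B : Fm} : DervI b Γ A → DervI b Γ (.or A B)
  | orI2 {b : Bool} {Γ : Set Fm} {A B : Fm} : DervI b Γ B → DervI b Γ (.or A B)
  | orE {b : Bool} {Γ : Set Fm} {A B C : Fm} : DervI b Γ (.or A B) → DervI b (insert A Γ) C →
      DervI b (insert B Γ) C → DervI b Γ C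
  | botE {b : Bool} {Γ : Set Fm} {A : Fm} : A.Atomic → DervI b Γ .bot → DervI b Γ A
  | allI {b : Bool} {Γ : Set Fm} {x y : ℕ} {A : Fm} : NotFreeIn y Γ → (y = x ∨ y ∉ A.fv) →
      A.freeFor (.var y) x → DervI b Γ (A.subst x (.var y)) → DervI b Γ (.all x A)
  | allE {b : Bool} {Γ : Set Fm} {x : ℕ} {A : Fm} {t : Tm} : A.freeFor t x →
      DervI b Γ (.all x A) → DervI b Γ (A.subst x t)
  | exI {b : Bool} {Γ : Set Fm} {x : ℕ} {A : Fm} {t : Tm} : A.freeFor t x →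
      DervI b Γ (A.subst x t) → DervI b Γ (.ex x A)
  | exE {b : Bool} {Γ : Set Fm} {x y : ℕ} {A C : Fm} : DervI b Γ (.ex x A) → NotFreeIn y Γ →
      y ∉ C.fv → (y = x ∨ y ∉ A.fv) → A.freeFor (.var y) x →
      DervI b (insert (A.subst x (.var y)) Γ) C → DervI b Γ C
  | eqI {Γ : Set Fm} (t : Tm) : DervI true Γ (.eq t t)
  | eqE {Γ : Set Fm} {x : ℕ} {A : Fm} {t₁ t₂ : Tm} : A.Atomic → DervI true Γ (.eq t₁ t₂) →
      DervI true Γ (A.subst x t₁) → DervI true Γ (A.subst x t₂)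
  | iotaI {b : Bool} {Γ : Set Fm} {x z : ℕ} {F G : Fm} {t : Tm} : F.freeFor t x → G.freeFor t x →
      z ≠ x → z ∉ t.fv → NotFreeIn z Γ → F.freeFor (.var z) x →
      DervI b Γ (F.subst x t) → DervI b Γ (G.subst x t) →
      DervI b (insert (F.subst x (.var z)) Γ) (.eq (.var z) t) →
      DervI b Γ (.iota x F G)
  | iotaE1 {b : Bool} {Γ : Set Fm} {x z : ℕ} {F G C : Fm} : DervI b Γ (.iota x F G) →
      NotFreeIn z Γ → z ∉ C.fv → (z = x ∨ (z ∉ F.fv ∧ z ∉ G.fv)) →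
      F.freeFor (.var z) x → G.freeFor (.var z) x →
      DervI b (insert (F.subst x (.var z)) (insert (G.subst x (.var z)) Γ)) C →
      DervI b Γ C
  | iotaE2 {b : Bool} {Γ : Set Fm} {x : ℕ} {F G : Fm} {t₁ t₂ : Tm} : F.freeFor t₁ x →
      F.freeFor t₂ x → DervI b Γ (.iota x F G) → DervI b Γ (F.subst x t₁) →
      DervI b Γ (F.subst x t₂) → DervI b Γ (.eq t₁ t₂)

/-- The Russellian analysis `∃x(F ∧ ∀y(F[y/x] → y = x) ∧ G)` of
`The F is G`. -/
def Russell (F G : Fm) (x y : ℕ) : Fm :=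
  Fm.ex x (Fm.and
    (Fm.and F (Fm.all y (Fm.imp (F.subst x (Tm.var y)) (Fm.eq (Tm.var y) (Tm.var x)))))
    G)

theorem Tm.subst_self_var (v : ℕ) (t : Tm) : Tm.subst v (.var v) t = t := by
  induction t with
  | var x =>
    simp only [Tm.subst]
    split_ifs with h
    · rw [h]
    · rfl
  | func f n ts ih =>
    simp only [Tm.subst]
    congr 1
    funext i
    exact ih i

theorem Fm.subst_self_var (v : ℕ) (A : Fm) : A.subst v (.var v) = A := by
  induction A <;> simp_all [Fm.subst, Tm.subst_self_var]

theorem Fm.freeFor_self_var (v : ℕ) (A : Fm) : A.freeFor (.var v) v := by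
  induction A with
  | all x A ih | ex x A ih =>
    by_cases h : v = x
    · exact Or.inl h
    · refine Or.inr (Or.inr ⟨?_, ih⟩)
      simpa [Tm.fv] using fun e => h e.symm
  | iota x F G ihF ihG =>
    by_cases h : v = x
    · exact Or.inl h
    · refine Or.inr (Or.inr ⟨?_, ihF, ihG⟩)
      simpa [Tm.fv] using fun e => h e.symm
  | _ => simp_all [Fm.freeFor]

/-- In `I^ι`, `∃x(F ∧ ∀y(F[y/x] → y = x) ∧ G)` is derivable from the single
assumption `ιx[F, G]`, for any variable `y` distinct from `x` and not free in
`F` or in `G` (with `y` free for `x` in `F`, as substitution is assumed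
capture-avoiding); moreover, since this holds for every value of the Boolean
flag, in particular for `b = false`, there is such a derivation using no
application of the identity rules `=I` and `=E`. -/
theorem iota_derives_russell_in_I (F G : Fm) (x y : ℕ) (hyx : y ≠ x)
    (hyF : y ∉ F.fv) (hyG : y ∉ G.fv) (hfree : F.freeFor (Tm.var y) x)
    (b : Bool) :
    DervI b {Fm.iota x F G} (Russell F G x y) := by
  have hι : NotFreeIn x {Fm.iota x F G} := by
    intro B hB
    rw [Set.mem_singleton_iff] at hB
    subst hB
    simp [Fm.fv]
  refine DervI.iotaE1 (x := x) (z := x) (F := F) (G := G) (DervI.hyp rfl) hι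
    (by simp [Russell, Fm.fv]) (Or.inl rfl)
    (Fm.freeFor_self_var x F) (Fm.freeFor_self_var x G) ?_
  rw [Fm.subst_self_var, Fm.subst_self_var]
  refine DervI.exI (t := .var x) (Fm.freeFor_self_var x _) ?_
  rw [Fm.subst_self_var]
  refine DervI.andI (DervI.andI (DervI.hyp (by simp)) ?_) (DervI.hyp (by simp))
  refine DervI.allI (y := y) ?_ (Or.inl rfl) (Fm.freeFor_self_var y _) ?_
  · intro B hB
    simp only [Set.mem_insert_iff, Set.mem_singleton_iff] at hB
    rcases hB with rfl | rfl | rfl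
    · exact hyF
    · exact hyG
    · simp [Fm.fv, hyF, hyG]
  · rw [Fm.subst_self_var]
    refine DervI.impI ?_
    refine DervI.iotaE2 (x := x) (F := F) (G := G) hfree (Fm.freeFor_self_var x F)
      (DervI.hyp (by simp)) (DervI.hyp (by simp)) ?_
    rw [Fm.subst_self_var]
    exact DervI.hyp (by simp)
end

section
/- In the system I^ι, for any formulas F and G, any variable x, and any variable y distinct from x and not free in F or in G, the formula ιx[F, G] is derivable from the single assumption ∃x(F ∧ ∀y(F[y/x] → y = x) ∧ G); moreover there is such a derivation that uses no application of the identity rules =I and =E. -/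
theorem Tm.subst_self (x : ℕ) (t : Tm) : Tm.subst x (.var x) t = t := by
  induction t with
  | var z => by_cases h : z = x <;> simp [Tm.subst, h]
  | func f n ts ih => simp [Tm.subst, ih]

theorem Fm.subst_self (x : ℕ) (A : Fm) : A.subst x (.var x) = A := by
  induction A <;> simp_all [Fm.subst, Tm.subst_self]

theorem Fm.freeFor_self (x : ℕ) (A : Fm) : A.freeFor (.var x) x := by
  induction A <;> simp_all [Fm.freeFor, Tm.fv] <;> grind

/-- In `I^ι`, `ιx[F, G]` is derivable from the single assumption
`∃x(F ∧ ∀y(F[y/x] → y = x) ∧ G)`, for any variable `y` distinct from `x` and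
not free in `F` or in `G` (with `y` free for `x` in `F`, as substitution is
assumed capture-avoiding); moreover, since this holds for every value of the
Boolean flag, in particular for `b = false`, there is such a derivation using
no application of the identity rules `=I` and `=E`. -/
theorem russell_derives_iota_in_I (F G : Fm) (x y : ℕ) (hyx : y ≠ x)
    (hyF : y ∉ F.fv) (hyG : y ∉ G.fv) (hfree : F.freeFor (Tm.var y) x)
    (b : Bool) :
    DervI b {Russell F G x y} (Fm.iota x F G) := by
  have hRy : y ∉ (Russell F G x y).fv := by
    simp [Russell, Fm.fv, hyF, hyG]
  have hRx : x ∉ (Russell F G x y).fv := by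
    simp [Russell, Fm.fv]
  refine DervI.exE (y := x) (DervI.hyp (Set.mem_singleton _)) ?_ ?_ (Or.inl rfl)
    (Fm.freeFor_self _ _) ?_
  · intro B hB
    rw [Set.mem_singleton_iff.1 hB]
    exact hRx
  · simp [Fm.fv]
  · rw [Fm.subst_self]
    refine DervI.iotaI (z := y) (t := .var x) (Fm.freeFor_self _ _) (Fm.freeFor_self _ _) hyx
      (by simpa [Tm.fv] using hyx) ?_ hfree ?_ ?_ ?_
    · intro B hB
      rcases hB with rfl | hB
      · simp [Fm.fv, hyF, hyG]
      · rw [Set.mem_singleton_iff.1 hB]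
        exact hRy
    · rw [Fm.subst_self]
      exact DervI.andE1 (DervI.andE1 (DervI.hyp (Set.mem_insert _ _)))
    · rw [Fm.subst_self]
      exact DervI.andE2 (DervI.hyp (Set.mem_insert _ _))
    · refine DervI.impE ?_ (DervI.hyp (Set.mem_insert _ _))
      have h := DervI.allE (t := .var y) (Fm.freeFor_self y _)
        (DervI.andE2 (DervI.andE1 (DervI.hyp (b := b) (Set.mem_insert_of_mem
          (F.subst x (.var y)) (Set.mem_insert (Fm.and
            (Fm.and F (Fm.all y (Fm.imp (F.subst x (Tm.var y)) (Fm.eq (Tm.var y) (Tm.var x)))))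
            G) {Russell F G x y})))))
      rw [Fm.subst_self] at h
      exact h
end

section
/- In the system INF^ι, for any formulas F and G, any variable x, and any variable y distinct from x and not free in F or in G, the formula ιx[F, G] is derivable from the single assumption ∃x(F ∧ ∀y(F[y/x] → y = x) ∧ G). -/
/-- Derivability in `INF^ι`: intuitionist negative free logic with the binary
quantifier `ι` governed by `ιI`, `ιE¹` and `ιE²`. `DervNI Γ A` holds iff there
is a deduction of `A` all of whose undischarged assumptions are in `Γ`. -/
inductive DervNI : Set Fm → Fm → Prop
  | hyp {Γ : Set Fm} {A : Fm} : A ∈ Γ → DervNI Γ A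
  | andI {Γ : Set Fm} {A B : Fm} : DervNI Γ A → DervNI Γ B → DervNI Γ (.and A B)
  | andE1 {Γ : Set Fm} {A B : Fm} : DervNI Γ (.and A B) → DervNI Γ A
  | andE2 {Γ : Set Fm} {A B : Fm} : DervNI Γ (.and A B) → DervNI Γ B
  | impI {Γ : Set Fm} {A B : Fm} : DervNI (insert A Γ) B → DervNI Γ (.imp A B)
  | impE {Γ : Set Fm} {A B : Fm} : DervNI Γ (.imp A B) → DervNI Γ A → DervNI Γ B
  | orI1 {Γ : Set Fm} {A B : Fm} : DervNI Γ A → DervNI Γ (.or A B)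
  | orI2 {Γ : Set Fm} {A B : Fm} : DervNI Γ B → DervNI Γ (.or A B)
  | orE {Γ : Set Fm} {A B C : Fm} : DervNI Γ (.or A B) → DervNI (insert A Γ) C →
      DervNI (insert B Γ) C → DervNI Γ C
  | botE {Γ : Set Fm} {A : Fm} : A.Atomic → DervNI Γ .bot → DervNI Γ A
  | allI {Γ : Set Fm} {x y : ℕ} {A : Fm} : NotFreeIn y Γ → (y = x ∨ y ∉ A.fv) → A.freeFor (.var y) x →
      DervNI (insert (.exi (.var y)) Γ) (A.subst x (.var y)) → DervNI Γ (.all x A)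
  | allE {Γ : Set Fm} {x : ℕ} {A : Fm} {t : Tm} : A.freeFor t x → DervNI Γ (.all x A) → DervNI Γ (.exi t) →
      DervNI Γ (A.subst x t)
  | exI {Γ : Set Fm} {x : ℕ} {A : Fm} {t : Tm} : A.freeFor t x → DervNI Γ (A.subst x t) → DervNI Γ (.exi t) →
      DervNI Γ (.ex x A)
  | exE {Γ : Set Fm} {x y : ℕ} {A C : Fm} : DervNI Γ (.ex x A) → NotFreeIn y Γ → y ∉ C.fv →
      (y = x ∨ y ∉ A.fv) → A.freeFor (.var y) x →
      DervNI (insert (A.subst x (.var y)) (insert (.exi (.var y)) Γ)) C → DervNI Γ C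
  | eqIn {Γ : Set Fm} {t : Tm} : DervNI Γ (.exi t) → DervNI Γ (.eq t t)
  | eqE {Γ : Set Fm} {x : ℕ} {A : Fm} {t₁ t₂ : Tm} : A.Atomic → DervNI Γ (.eq t₁ t₂) →
      DervNI Γ (A.subst x t₁) → DervNI Γ (A.subst x t₂)
  | ad {Γ : Set Fm} {P n : ℕ} {ts : Fin n → Tm} (i : Fin n) : DervNI Γ (.atom P n ts) → DervNI Γ (.exi (ts i))
  | adEq1 {Γ : Set Fm} {t u : Tm} : DervNI Γ (.eq t u) → DervNI Γ (.exi t)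
  | adEq2 {Γ : Set Fm} {t u : Tm} : DervNI Γ (.eq t u) → DervNI Γ (.exi u)
  | fd {Γ : Set Fm} {f n : ℕ} {ts : Fin n → Tm} (i : Fin n) : DervNI Γ (.exi (.func f n ts)) → DervNI Γ (.exi (ts i))
  | iotaI {Γ : Set Fm} {x z : ℕ} {F G : Fm} {t : Tm} : F.freeFor t x → G.freeFor t x → z ≠ x → z ∉ t.fv →
      NotFreeIn z Γ → F.freeFor (.var z) x →
      DervNI Γ (F.subst x t) → DervNI Γ (G.subst x t) → DervNI Γ (.exi t) →
      DervNI (insert (F.subst x (.var z)) (insert (.exi (.var z)) Γ)) (.eq (.var z) t) →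
      DervNI Γ (.iota x F G)
  | iotaE1 {Γ : Set Fm} {x z : ℕ} {F G C : Fm} : DervNI Γ (.iota x F G) → NotFreeIn z Γ → z ∉ C.fv →
      (z = x ∨ (z ∉ F.fv ∧ z ∉ G.fv)) → F.freeFor (.var z) x → G.freeFor (.var z) x →
      DervNI (insert (F.subst x (.var z))
        (insert (G.subst x (.var z)) (insert (.exi (.var z)) Γ))) C →
      DervNI Γ C
  | iotaE2 {Γ : Set Fm} {x : ℕ} {F G : Fm} {t₁ t₂ : Tm} : F.freeFor t₁ x → F.freeFor t₂ x →
      DervNI Γ (.iota x F G) → DervNI Γ (.exi t₁) → DervNI Γ (.exi t₂) →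
      DervNI Γ (F.subst x t₁) → DervNI Γ (F.subst x t₂) → DervNI Γ (.eq t₁ t₂)

/-- In `INF^ι`, `ιx[F, G]` is derivable from the single assumption
`∃x(F ∧ ∀y(F[y/x] → y = x) ∧ G)`, for any variable `y` distinct from `x` and
not free in `F` or in `G` (with `y` free for `x` in `F`, as substitution is
assumed capture-avoiding). -/
theorem russell_derives_iota_in_INF (F G : Fm) (x y : ℕ) (hyx : y ≠ x)
    (hyF : y ∉ F.fv) (hyG : y ∉ G.fv) (hfree : F.freeFor (Tm.var y) x) :
    DervNI {Russell F G x y} (Fm.iota x F G) := by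
  have hnf : NotFreeIn x {Russell F G x y} := by
    intro B hB
    rw [Set.mem_singleton_iff.1 hB]
    simp [Russell, Fm.fv]
  refine DervNI.exE (x := x) (y := x) (DervNI.hyp (Set.mem_singleton _)) hnf
    (by simp [Fm.fv]) (Or.inl rfl) (Fm.freeFor_self_var _ _) ?_
  rw [Fm.subst_self_var]
  refine DervNI.iotaI (z := y) (t := .var x) (Fm.freeFor_self_var _ _)
    (Fm.freeFor_self_var _ _) hyx (by simpa [Tm.fv] using hyx) ?_ hfree ?_ ?_ ?_ ?_
  · intro B hB
    simp only [Set.mem_insert_iff, Set.mem_singleton_iff] at hB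
    rcases hB with rfl | rfl | rfl <;> simp [Russell, Fm.fv, Tm.fv, hyx, hyF, hyG]
  · rw [Fm.subst_self_var]
    exact DervNI.andE1 (DervNI.andE1 (DervNI.hyp (Set.mem_insert _ _)))
  · rw [Fm.subst_self_var]
    exact DervNI.andE2 (DervNI.hyp (Set.mem_insert _ _))
  · exact DervNI.hyp (by simp)
  · refine DervNI.impE (A := F.subst x (.var y)) ?_ (DervNI.hyp (by simp))
    rw [← Fm.subst_self_var y (Fm.imp (F.subst x (.var y)) (.eq (.var y) (.var x)))]
    refine DervNI.allE (Fm.freeFor_self_var _ _) ?_ (DervNI.hyp (by simp))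
    exact DervNI.andE2 (A := F) (DervNI.andE1 (B := G) (DervNI.hyp (by simp [Fm.subst_self_var])))
end
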